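/- arXiv:2301.04116 — 9 statements merged into one kernel-verified Lean document; each statement's English description precedes it below -/
import Mathlib

section
/- Let p, q ∈ (0,1) and let r₁, r₂ be real numbers with 0 < r₁ < r₂ < 1, r₁ + r₂ = 1 − pq, and r₁·r₂ = (1−p)p(1−q)q. Let h̄ ∈ ℝ and define u : ℕ → ℝ by u_i = h̄·((r₂ − (1−pq))·r₁^i + ((1−pq) − r₁)·r₂^i)/(r₂ − r₁). Then the series Σ_{i=0}^∞ u_i converges and Σ_{i=0}^∞ u_i = h̄ / (pq·(1 + (1−p)(1−q))). -/
/-- The series of stationary probabilities of ages above the threshold converges and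
`Σ_{i=0}^∞ u_i = h̄ / (pq(1 + (1−p)(1−q)))`, where
`u_i = h̄((r₂−(1−pq))r₁^i + ((1−pq)−r₁)r₂^i)/(r₂−r₁)` and `0 < r₁ < r₂ < 1` are the
roots of the characteristic quadratic. -/
theorem tail_sum_of_stationary_probabilities
    (p q : ℝ) (hp0 : 0 < p) (hp1 : p < 1) (hq0 : 0 < q) (hq1 : q < 1)
    (r₁ r₂ : ℝ) (hr1 : 0 < r₁) (hr12 : r₁ < r₂) (hr2 : r₂ < 1)
    (hsum : r₁ + r₂ = 1 - p * q)
    (hprod : r₁ * r₂ = (1 - p) * p * (1 - q) * q)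
    (hbar : ℝ) (u : ℕ → ℝ)
    (hu : ∀ i : ℕ,
      u i = hbar * ((r₂ - (1 - p * q)) * r₁ ^ i + ((1 - p * q) - r₁) * r₂ ^ i) / (r₂ - r₁)) :
    Summable u ∧ ∑' i : ℕ, u i = hbar / (p * q * (1 + (1 - p) * (1 - q))) := by
  have hden : p * q * (1 + (1 - p) * (1 - q)) = (1 - r₁) * (1 - r₂) := by
    linear_combination hsum - hprod
  have h₁ : 1 - r₁ ≠ 0 := by linarith
  have h₂ : 1 - r₂ ≠ 0 := by linarith
  have h₁₂ : r₂ - r₁ ≠ 0 := by linarith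
  have hgeom := ((((hasSum_geometric_of_lt_one (hr1.trans hr12).le hr2).mul_left r₂).sub
    ((hasSum_geometric_of_lt_one hr1.le (hr12.trans hr2)).mul_left r₁)).mul_left hbar).div_const
    (r₂ - r₁)
  have hu_eq : u = fun i => hbar * (r₂ * r₂ ^ i - r₁ * r₁ ^ i) / (r₂ - r₁) := by
    funext i
    rw [hu, ← hsum]
    ring
  have hvalue : hbar / (p * q * (1 + (1 - p) * (1 - q))) =
      hbar * (r₂ * (1 - r₂)⁻¹ - r₁ * (1 - r₁)⁻¹) / (r₂ - r₁) := by
    rw [hden]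
    field_simp
    ring
  rw [hu_eq, hvalue]
  exact ⟨hgeom.summable, hgeom.tsum_eq⟩
end

section
/- Let p, q ∈ (0,1), let v̄ ≥ 2 be an integer, and let h₂ ∈ ℝ. Let r₁, r₂ be real numbers with 0 < r₁ < r₂ < 1, r₁ + r₂ = 1 − pq, r₁·r₂ = (1−p)p(1−q)q, and define u : ℕ → ℝ by u_i = (1−pq)^{v̄−2}·h₂·((r₂ − (1−pq))·r₁^i + ((1−pq) − r₁)·r₂^i)/(r₂ − r₁). Then pq·(Σ_{j=2}^{v̄−1} (1−pq)^{j−2}·h₂) + pq·(Σ_{i=0}^∞ u_i) = (1 − (1−pq)^{v̄−2})·h₂ + (1−pq)^{v̄−2}·h₂/(1 + (1−p)(1−q)). -/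
/-- The finite geometric sum over `Finset.Icc 2 (n + 1)` with exponents shifted by two. -/
lemma one_sub_mul_sum_Icc_two_pow (x : ℝ) (n : ℕ) :
    (1 - x) * ∑ j ∈ Finset.Icc 2 (n + 1), x ^ (j - 2) = 1 - x ^ n := by
  induction n with
  | zero => simp
  | succ k ih =>
    rw [Finset.sum_Icc_succ_top (by omega), mul_add, ih, show k + 1 + 1 - 2 = k by omega]
    ring

/-- The complete homogeneous sums `(b ^ (i + 1) - a ^ (i + 1)) / (b - a)` have generating value
`1 / ((1 - a) * (1 - b))`. -/
lemma hasSum_pow_succ_sub_pow_succ_div {a b : ℝ} (ha0 : 0 ≤ a) (hab : a < b) (hb1 : b < 1) :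
    HasSum (fun i : ℕ => (b * b ^ i - a * a ^ i) / (b - a)) (((1 - a) * (1 - b))⁻¹) := by
  have ha := (hasSum_geometric_of_lt_one ha0 (hab.trans hb1)).mul_left a
  have hb := (hasSum_geometric_of_lt_one (ha0.trans hab.le) hb1).mul_left b
  have h1 : 1 - a ≠ 0 := by linarith
  have h2 : 1 - b ≠ 0 := by linarith
  have h3 : b - a ≠ 0 := by linarith
  have hval : ((1 - a) * (1 - b))⁻¹ = (b * (1 - b)⁻¹ - a * (1 - a)⁻¹) / (b - a) := by
    field_simp
    ring
  rw [hval]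
  exact (hb.sub ha).div_const (b - a)

/-- Balance equation for the stationary probability of age 1: with
`h_j = (1−pq)^{j−2}h₂` for `2 ≤ j ≤ vbar` and tail probabilities
`u_i = (1−pq)^{vbar−2}h₂((r₂−(1−pq))r₁^i + ((1−pq)−r₁)r₂^i)/(r₂−r₁)`,
`pq·Σ_{j=2}^{vbar−1} h_j + pq·Σ_{i=0}^∞ u_i
  = (1−(1−pq)^{vbar−2})h₂ + (1−pq)^{vbar−2}h₂/(1+(1−p)(1−q))`. -/
theorem balance_equation_age_one
    (p q : ℝ) (hp0 : 0 < p) (hp1 : p < 1) (hq0 : 0 < q) (hq1 : q < 1)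
    (vbar : ℕ) (hvbar : 2 ≤ vbar) (h₂ : ℝ)
    (r₁ r₂ : ℝ) (hr1 : 0 < r₁) (hr12 : r₁ < r₂) (hr2 : r₂ < 1)
    (hsum : r₁ + r₂ = 1 - p * q)
    (hprod : r₁ * r₂ = (1 - p) * p * (1 - q) * q)
    (u : ℕ → ℝ)
    (hu : ∀ i : ℕ,
      u i = (1 - p * q) ^ (vbar - 2) * h₂ *
        ((r₂ - (1 - p * q)) * r₁ ^ i + ((1 - p * q) - r₁) * r₂ ^ i) / (r₂ - r₁)) :
    p * q * (∑ j ∈ Finset.Icc 2 (vbar - 1), (1 - p * q) ^ (j - 2) * h₂) +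
      p * q * (∑' i : ℕ, u i) =
    (1 - (1 - p * q) ^ (vbar - 2)) * h₂ +
      (1 - p * q) ^ (vbar - 2) * h₂ / (1 + (1 - p) * (1 - q)) := by
  obtain ⟨n, rfl⟩ := Nat.exists_eq_add_of_le' hvbar
  simp only [Nat.add_sub_cancel, show n + 2 - 1 = n + 1 by omega] at hu ⊢
  have hu_sum : HasSum u ((1 - p * q) ^ n * h₂ * ((1 - r₁) * (1 - r₂))⁻¹) := by
    have hu_eq : u = fun i => (1 - p * q) ^ n * h₂ * ((r₂ * r₂ ^ i - r₁ * r₁ ^ i) / (r₂ - r₁)) := by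
      funext i
      rw [hu, show r₂ - (1 - p * q) = -r₁ by linarith, show 1 - p * q - r₁ = r₂ by linarith]
      ring
    rw [hu_eq]
    exact (hasSum_pow_succ_sub_pow_succ_div hr1.le hr12 hr2).mul_left _
  have hfin := one_sub_mul_sum_Icc_two_pow (1 - p * q) n
  rw [sub_sub_cancel] at hfin
  have hroots : (1 - r₁) * (1 - r₂) = p * q * (1 + (1 - p) * (1 - q)) := by
    linear_combination hprod - hsum
  have hden : 1 + (1 - p) * (1 - q) ≠ 0 := by
    have := mul_pos (sub_pos.2 hp1) (sub_pos.2 hq1)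
    positivity
  rw [hu_sum.tsum_eq, hroots, ← Finset.sum_mul, ← mul_assoc, hfin]
  field_simp
end

section
/- Let p, q ∈ (0,1), let v̄ ≥ 2 be an integer, and let h₂ > 0. Let r₁, r₂ be real numbers with 0 < r₁ < r₂ < 1, r₁ + r₂ = 1 − pq, r₁·r₂ = (1−p)p(1−q)q. Define h₁ = (1 − (1−pq)^{v̄−2})·h₂ + (1−pq)^{v̄−2}·h₂/(1 + (1−p)(1−q)), h_j = (1−pq)^{j−2}·h₂ for 2 ≤ j ≤ v̄−1, and h_{v̄+i} = (1−pq)^{v̄−2}·h₂·((r₂ − (1−pq))·r₁^i + ((1−pq) − r₁)·r₂^i)/(r₂ − r₁) for i ≥ 0. Then h₁ + Σ_{j=2}^{v̄−1} h_j + Σ_{i=0}^∞ h_{v̄+i} = 1 if and only if h₂ = pq·(1 + (1−p)(1−q)) / ((1 + pq)·(1 + (1−p)(1−q) − (1−pq)^{v̄−2}·(1−p)(1−q))). -/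
/-- The generating series of the complete homogeneous polynomials in two variables, at `1`. -/
theorem hasSum_pow_succ_sub_pow_succ_div_s4 {r s : ℝ} (hr : |r| < 1) (hs : |s| < 1) (hrs : r ≠ s) :
    HasSum (fun i : ℕ => (s ^ (i + 1) - r ^ (i + 1)) / (s - r)) (1 / ((1 - r) * (1 - s))) := by
  have h := (((hasSum_geometric_of_abs_lt_one hs).mul_left s).sub
    ((hasSum_geometric_of_abs_lt_one hr).mul_left r)).div_const (s - r)
  have hr' : 1 - r ≠ 0 := sub_ne_zero.mpr (by linarith [(abs_lt.mp hr).2] : r < 1).ne'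
  have hs' : 1 - s ≠ 0 := sub_ne_zero.mpr (by linarith [(abs_lt.mp hs).2] : s < 1).ne'
  have hsr : s - r ≠ 0 := sub_ne_zero.mpr hrs.symm
  have hval : 1 / ((1 - r) * (1 - s)) = (s * (1 - s)⁻¹ - r * (1 - r)⁻¹) / (s - r) := by
    field_simp
    ring
  simpa only [pow_succ', hval] using h

/-- A finite geometric sum indexed from `2`. -/
theorem sum_Icc_two_pow_sub_two {a : ℝ} (ha : a ≠ 1) (n : ℕ) :
    ∑ j ∈ Finset.Icc 2 (n + 1), a ^ (j - 2) = (1 - a ^ n) / (1 - a) := by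
  rw [← Finset.Ico_add_one_right_eq_Icc, Finset.sum_Ico_eq_sum_range]
  simp only [Nat.add_sub_cancel_left, show n + 1 + 1 - 2 = n by omega]
  rw [geom_sum_eq ha, ← neg_div_neg_eq, neg_sub, neg_sub]

/-- Normalization of the stationary distribution of the threshold-`v̄` policy:
the total probability `h₁ + Σ_{j=2}^{v̄−1} h_j + Σ_{i=0}^∞ h_{v̄+i}` equals `1`
if and only if
`h₂ = pq(1+(1−p)(1−q)) / ((1+pq)(1+(1−p)(1−q) − (1−pq)^{v̄−2}(1−p)(1−q)))`. -/
theorem normalization_constant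
    (p q : ℝ) (hp0 : 0 < p) (hp1 : p < 1) (hq0 : 0 < q) (hq1 : q < 1)
    (vbar : ℕ) (hvbar : 2 ≤ vbar) (h₂ : ℝ) (hh₂ : 0 < h₂)
    (r₁ r₂ : ℝ) (hr1 : 0 < r₁) (hr12 : r₁ < r₂) (hr2 : r₂ < 1)
    (hsum : r₁ + r₂ = 1 - p * q)
    (hprod : r₁ * r₂ = (1 - p) * p * (1 - q) * q)
    (h₁ : ℝ)
    (hh₁ : h₁ = (1 - (1 - p * q) ^ (vbar - 2)) * h₂ +
      (1 - p * q) ^ (vbar - 2) * h₂ / (1 + (1 - p) * (1 - q)))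
    (u : ℕ → ℝ)
    (hu : ∀ i : ℕ,
      u i = (1 - p * q) ^ (vbar - 2) * h₂ *
        ((r₂ - (1 - p * q)) * r₁ ^ i + ((1 - p * q) - r₁) * r₂ ^ i) / (r₂ - r₁)) :
    (h₁ + (∑ j ∈ Finset.Icc 2 (vbar - 1), (1 - p * q) ^ (j - 2) * h₂) +
        (∑' i : ℕ, u i) = 1) ↔
      h₂ = p * q * (1 + (1 - p) * (1 - q)) /
        ((1 + p * q) *
          (1 + (1 - p) * (1 - q) - (1 - p * q) ^ (vbar - 2) * (1 - p) * (1 - q))) := by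
  obtain ⟨n, rfl⟩ := Nat.exists_eq_add_of_le' hvbar
  have hpq : 0 < p * q := mul_pos hp0 hq0
  have hpq1 : p * q < 1 := mul_lt_one_of_nonneg_of_lt_one_left hp0.le hp1 hq1.le
  have hc : 0 < (1 - p) * (1 - q) := mul_pos (sub_pos.mpr hp1) (sub_pos.mpr hq1)
  have hA : (1 - p * q) ^ n ≤ 1 := pow_le_one₀ (by linarith) (by linarith)
  have hroots : (1 - r₁) * (1 - r₂) = p * q * (1 + (1 - p) * (1 - q)) := by
    linear_combination hprod - hsum
  have htail : ∑' i, u i =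
      (1 - p * q) ^ n * h₂ * (1 / (p * q * (1 + (1 - p) * (1 - q)))) := by
    rw [← hroots]
    have h := (hasSum_pow_succ_sub_pow_succ_div_s4
      (abs_lt.mpr ⟨by linarith, by linarith⟩ : |r₁| < 1)
      (abs_lt.mpr ⟨by linarith, hr2⟩ : |r₂| < 1) hr12.ne).mul_left ((1 - p * q) ^ n * h₂)
    rw [← h.tsum_eq]
    refine tsum_congr fun i => ?_
    rw [hu, Nat.add_sub_cancel, ← hsum]
    ring
  rw [htail, hh₁, ← Finset.sum_mul, Nat.add_sub_cancel, show n + 2 - 1 = n + 1 from rfl,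
    sum_Icc_two_pow_sub_two (by linarith), sub_sub_cancel, mul_assoc ((1 - p * q) ^ n) (1 - p)]
  generalize (1 - p * q) ^ n = A at *
  generalize (1 - p) * (1 - q) = c at *
  generalize p * q = t at *
  have hden : 0 < 1 + c - A * c := by nlinarith
  have hc1 : 0 < 1 + c := by linarith
  have htotal : (1 - A) * h₂ + A * h₂ / (1 + c) + (1 - A) / t * h₂ +
      A * h₂ * (1 / (t * (1 + c))) = h₂ * ((1 + t) * (1 + c - A * c)) / (t * (1 + c)) := by
    field_simp
    ring
  rw [htotal, div_eq_one_iff_eq (by positivity), eq_div_iff (by positivity)]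
end

section
/- Let p, q ∈ (0,1), let v̄ ≥ 2 be an integer, and let h₂ > 0. Let r₁, r₂ be real numbers with 0 < r₁ < r₂ < 1, r₁ + r₂ = 1 − pq, r₁·r₂ = (1−p)p(1−q)q. Define h₁ = (1 − (1−pq)^{v̄−2})·h₂ + (1−pq)^{v̄−2}·h₂/(1 + (1−p)(1−q)), h_j = (1−pq)^{j−2}·h₂ for 2 ≤ j ≤ v̄, and h_{v̄+i} = (1−pq)^{v̄−2}·h₂·((r₂ − (1−pq))·r₁^i + ((1−pq) − r₁)·r₂^i)/(r₂ − r₁) for i ≥ 0. Then: (i) h_{j+1} = (1−pq)·h_j for all 2 ≤ j ≤ v̄ (where h_{v̄+1} denotes the i = 1 member of the tail family); (ii) h_{v̄+i+2} = ((1−p)+p(1−q))·h_{v̄+i+1} − (1−p)p(1−q)q·h_{v̄+i} for all i ≥ 0; (iii) h₁ = pq·Σ_{j=2}^{v̄−1} h_j + pq·Σ_{i=0}^∞ h_{v̄+i}, with the series converging; and (iv) h₁ > 0 and h_j > 0 for 2 ≤ j ≤ v̄ and h_{v̄+i} > 0 for all i ≥ 0. -/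
/-- The divided differences `(y ^ (i + 1) - x ^ (i + 1)) / (y - x)` are the complete homogeneous
symmetric polynomials in `x` and `y`, whose generating series at `1` is `1 / ((1 - x) * (1 - y))`. -/
theorem hasSum_pow_succ_sub_pow_succ_div_s5 {x y : ℝ} (hx : |x| < 1) (hy : |y| < 1) (hxy : x ≠ y) :
    HasSum (fun i : ℕ => (y ^ (i + 1) - x ^ (i + 1)) / (y - x)) (1 / ((1 - x) * (1 - y))) := by
  have hx1 : 1 - x ≠ 0 := (sub_pos.2 (abs_lt.1 hx).2).ne'
  have hy1 : 1 - y ≠ 0 := (sub_pos.2 (abs_lt.1 hy).2).ne'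
  have hyx : y - x ≠ 0 := sub_ne_zero.2 hxy.symm
  have hterm (i : ℕ) : (y ^ (i + 1) - x ^ (i + 1)) / (y - x) =
      (y * y ^ i - x * x ^ i) / (y - x) := by ring
  have hvalue : 1 / ((1 - x) * (1 - y)) = (y * (1 - y)⁻¹ - x * (1 - x)⁻¹) / (y - x) := by
    field_simp
    ring
  rw [funext hterm, hvalue]
  exact (((hasSum_geometric_of_abs_lt_one hy).mul_left y).sub
    ((hasSum_geometric_of_abs_lt_one hx).mul_left x)).div_const (y - x)

/-- The family `h₁`, `h_j = (1−pq)^{j−2}h₂` (for `2 ≤ j ≤ v̄`) and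
`h_{v̄+i} = u_i` (the tail family) of the threshold-`v̄` policy satisfies:
(i) the one-step balance `h_{j+1} = (1−pq)h_j` for `2 ≤ j ≤ v̄`
    (where `h_{v̄+1}` denotes `u 1`);
(ii) the second-order recurrence above the threshold;
(iii) the balance equation `h₁ = pq·Σ_{j=2}^{v̄−1} h_j + pq·Σ_{i=0}^∞ u_i`,
      with the series converging; and
(iv) strict positivity of all the stationary probabilities.
Here `H j` encodes `h_j` for `j ≥ 2`: `H j = (1−pq)^{j−2}h₂` for `2 ≤ j ≤ v̄`
and `H (v̄+i) = u i` for `i ≥ 1`. -/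
theorem stationary_distribution_properties
    (p q : ℝ) (hp0 : 0 < p) (hp1 : p < 1) (hq0 : 0 < q) (hq1 : q < 1)
    (vbar : ℕ) (hvbar : 2 ≤ vbar) (h₂ : ℝ) (hh₂ : 0 < h₂)
    (r₁ r₂ : ℝ) (hr1 : 0 < r₁) (hr12 : r₁ < r₂) (hr2 : r₂ < 1)
    (hsum : r₁ + r₂ = 1 - p * q)
    (hprod : r₁ * r₂ = (1 - p) * p * (1 - q) * q)
    (h₁ : ℝ)
    (hh₁ : h₁ = (1 - (1 - p * q) ^ (vbar - 2)) * h₂ +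
      (1 - p * q) ^ (vbar - 2) * h₂ / (1 + (1 - p) * (1 - q)))
    (u : ℕ → ℝ)
    (hu : ∀ i : ℕ,
      u i = (1 - p * q) ^ (vbar - 2) * h₂ *
        ((r₂ - (1 - p * q)) * r₁ ^ i + ((1 - p * q) - r₁) * r₂ ^ i) / (r₂ - r₁))
    (H : ℕ → ℝ)
    (hH : ∀ j : ℕ, H j = if j ≤ vbar then (1 - p * q) ^ (j - 2) * h₂ else u (j - vbar)) :
    (∀ j : ℕ, 2 ≤ j → j ≤ vbar → H (j + 1) = (1 - p * q) * H j) ∧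
    (∀ i : ℕ,
      u (i + 2) = ((1 - p) + p * (1 - q)) * u (i + 1) - (1 - p) * p * (1 - q) * q * u i) ∧
    (Summable u ∧
      h₁ = p * q * (∑ j ∈ Finset.Icc 2 (vbar - 1), H j) + p * q * (∑' i : ℕ, u i)) ∧
    (0 < h₁ ∧ (∀ j : ℕ, 2 ≤ j → j ≤ vbar → 0 < H j) ∧ (∀ i : ℕ, 0 < u i)) := by
  obtain ⟨n, rfl⟩ := Nat.exists_eq_add_of_le' hvbar
  simp only [Nat.add_sub_cancel] at hh₁ hu
  have hpq : 0 < p * q := mul_pos hp0 hq0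
  have ha0 : 0 < 1 - p * q := by linarith
  have ha1 : 1 - p * q < 1 := by linarith
  have hd : 0 < r₂ - r₁ := sub_pos.2 hr12
  have hD : 0 < 1 + (1 - p) * (1 - q) := by
    have := mul_pos (sub_pos.2 hp1) (sub_pos.2 hq1)
    linarith
  have hA : 0 < (1 - p * q) ^ n * h₂ := mul_pos (pow_pos ha0 n) hh₂
  have hu' : ∀ i, u i = (1 - p * q) ^ n * h₂ * ((r₂ ^ (i + 1) - r₁ ^ (i + 1)) / (r₂ - r₁)) := by
    intro i
    rw [hu, ← hsum]
    ring
  have hHle : ∀ j ≤ n + 2, H j = (1 - p * q) ^ (j - 2) * h₂ := fun j hj => by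
    rw [hH, if_pos hj]
  have hsumu : HasSum u ((1 - p * q) ^ n * h₂ * (1 / ((1 - r₁) * (1 - r₂)))) := by
    rw [funext hu']
    exact (hasSum_pow_succ_sub_pow_succ_div_s5 (abs_lt.2 ⟨by linarith, by linarith⟩)
      (abs_lt.2 ⟨by linarith, hr2⟩) hr12.ne).mul_left _
  have hroots : (1 - r₁) * (1 - r₂) = p * q * (1 + (1 - p) * (1 - q)) := by
    linear_combination hprod - hsum
  refine ⟨?_, ?_, ⟨hsumu.summable, ?_⟩, ?_, ?_, ?_⟩
  · intro j hj2 hj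
    obtain ⟨k, rfl⟩ := Nat.exists_eq_add_of_le' hj2
    rw [hHle _ hj]
    rcases hj.lt_or_eq with hlt | heq
    · rw [hHle _ hlt, show k + 2 + 1 - 2 = k + 1 by omega, Nat.add_sub_cancel]
      ring
    · obtain rfl : k = n := by omega
      rw [hH, if_neg (by omega), Nat.add_sub_cancel_left, hu', Nat.add_sub_cancel, ← hsum]
      field_simp
      ring
  · intro i
    have hcoef : (1 - p) + p * (1 - q) = r₁ + r₂ := by linear_combination -hsum
    rw [hcoef, ← hprod, hu', hu', hu']
    ring
  · have hfin : ∑ j ∈ Finset.Icc 2 (n + 2 - 1), H j =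
        ∑ k ∈ Finset.range n, (1 - p * q) ^ k * h₂ := by
      rw [show Finset.Icc 2 (n + 2 - 1) = Finset.Ico 2 (n + 2) by ext; simp; omega,
        Finset.sum_Ico_eq_sum_range, Nat.add_sub_cancel]
      refine Finset.sum_congr rfl fun k hk => ?_
      rw [hHle _ (by have := Finset.mem_range.1 hk; omega), Nat.add_sub_cancel_left]
    have hgeom := mul_neg_geom_sum (1 - p * q) n
    rw [sub_sub_cancel] at hgeom
    rw [hfin, ← Finset.sum_mul, ← mul_assoc, hgeom, hsumu.tsum_eq, hroots, hh₁]
    field_simp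
  · rw [hh₁]
    have hle : 0 ≤ 1 - (1 - p * q) ^ n := sub_nonneg.2 (pow_le_one₀ ha0.le ha1.le)
    positivity
  · intro j _ hj
    rw [hHle j hj]
    positivity
  · intro i
    rw [hu']
    exact mul_pos hA (div_pos (sub_pos.2 (pow_lt_pow_left₀ hr12 hr1.le i.succ_ne_zero)) hd)
end

section
/- Let p, q ∈ (0,1), let c ≥ 0, let v̄ ≥ 2 be an integer, and let h̄ ∈ ℝ. Let r₁, r₂ be real numbers with 0 < r₁ < r₂ < 1, r₁ + r₂ = 1 − pq, r₁·r₂ = (1−p)p(1−q)q, and define u : ℕ → ℝ by u_i = h̄·((r₂ − (1−pq))·r₁^i + ((1−pq) − r₁)·r₂^i)/(r₂ − r₁). Then the series Σ_{i=0}^∞ u_i·(v̄ + i + c·p) converges and equals d·h̄ + h̄·v̄/(pq·(1 + (1−p)(1−q))), where d = c/(q·(1 + (1−p)(1−q))) + (r₂ − 1 + pq)·r₁/((r₂ − r₁)(1 − r₁)²) + (1 − pq − r₁)·r₂/((r₂ − r₁)(1 − r₂)²). -/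
/-- The arithmetico-geometric series `∑ (a + i) rⁱ`. -/
theorem hasSum_const_add_mul_geometric {r : ℝ} (hr0 : 0 ≤ r) (hr1 : r < 1) (a : ℝ) :
    HasSum (fun i : ℕ => (a + i) * r ^ i) (a * (1 - r)⁻¹ + r / (1 - r) ^ 2) := by
  have hr : ‖r‖ < 1 := by rwa [Real.norm_of_nonneg hr0]
  simpa only [add_mul] using ((hasSum_geometric_of_lt_one hr0 hr1).mul_left a).add
    (hasSum_coe_mul_geometric_of_norm_lt_one hr)

/-- Expected cost contributed by ages at or above the threshold `v̄`:
with `u_i = h̄((r₂−(1−pq))r₁^i + ((1−pq)−r₁)r₂^i)/(r₂−r₁)` the series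
`Σ_{i=0}^∞ u_i(v̄ + i + cp)` converges and equals
`d·h̄ + h̄·v̄/(pq(1+(1−p)(1−q)))`, where
`d = c/(q(1+(1−p)(1−q))) + (r₂−1+pq)r₁/((r₂−r₁)(1−r₁)²)
   + (1−pq−r₁)r₂/((r₂−r₁)(1−r₂)²)`. -/
theorem tail_expected_cost
    (p q c : ℝ) (hp0 : 0 < p) (hp1 : p < 1) (hq0 : 0 < q) (hq1 : q < 1) (hc : 0 ≤ c)
    (vbar : ℕ) (hvbar : 2 ≤ vbar) (hbar : ℝ)
    (r₁ r₂ : ℝ) (hr1 : 0 < r₁) (hr12 : r₁ < r₂) (hr2 : r₂ < 1)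
    (hsum : r₁ + r₂ = 1 - p * q)
    (hprod : r₁ * r₂ = (1 - p) * p * (1 - q) * q)
    (u : ℕ → ℝ)
    (hu : ∀ i : ℕ,
      u i = hbar * ((r₂ - (1 - p * q)) * r₁ ^ i + ((1 - p * q) - r₁) * r₂ ^ i) / (r₂ - r₁))
    (d : ℝ)
    (hd : d = c / (q * (1 + (1 - p) * (1 - q))) +
      (r₂ - 1 + p * q) * r₁ / ((r₂ - r₁) * (1 - r₁) ^ 2) +
      (1 - p * q - r₁) * r₂ / ((r₂ - r₁) * (1 - r₂) ^ 2)) :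
    Summable (fun i : ℕ => u i * ((vbar : ℝ) + (i : ℝ) + c * p)) ∧
      ∑' i : ℕ, u i * ((vbar : ℝ) + (i : ℝ) + c * p) =
        d * hbar + hbar * (vbar : ℝ) / (p * q * (1 + (1 - p) * (1 - q))) := by
  have hD : p * q * (1 + (1 - p) * (1 - q)) = (1 - r₁) * (1 - r₂) := by
    linear_combination hsum - hprod
  have hd₁ : 1 - r₁ ≠ 0 := by linarith
  have hd₂ : 1 - r₂ ≠ 0 := by linarith
  have hd₁₂ : r₂ - r₁ ≠ 0 := by linarith
  have hcost : c / (q * (1 + (1 - p) * (1 - q))) = c * p / ((1 - r₁) * (1 - r₂)) := by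
    rw [← hD, mul_comm c p, mul_assoc p, mul_div_mul_left _ _ hp0.ne']
  have hA : r₂ - (1 - p * q) = -r₁ := by linear_combination hsum
  have hA' : r₂ - 1 + p * q = -r₁ := by linear_combination hsum
  have hB : 1 - p * q - r₁ = r₂ := by linear_combination -hsum
  have h := (((hasSum_const_add_mul_geometric hr1.le (hr12.trans hr2)
    (vbar + c * p)).mul_left (-r₁)).add
    ((hasSum_const_add_mul_geometric (hr1.trans hr12).le hr2
    (vbar + c * p)).mul_left r₂)).mul_left (hbar / (r₂ - r₁))
  have key : HasSum (fun i : ℕ => u i * ((vbar : ℝ) + (i : ℝ) + c * p))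
      (d * hbar + hbar * (vbar : ℝ) / (p * q * (1 + (1 - p) * (1 - q)))) := by
    convert! h using 1
    · funext i
      rw [hu, hA, hB]
      ring
    · rw [hd, hcost, hD, hA', hB]
      field_simp
      ring
  exact ⟨key.summable, key.tsum_eq⟩
end

section
/- Let p, q ∈ (0,1), let c ≥ 0, and let r₁, r₂ be real numbers with 0 < r₁ < r₂ < 1, r₁ + r₂ = 1 − pq, r₁·r₂ = (1−p)p(1−q)q. Let h₂ ∈ ℝ, set h₁ = h₂/(1 + (1−p)(1−q)), and define u : ℕ → ℝ by u_i = h₂·((r₂ − (1−pq))·r₁^i + ((1−pq) − r₁)·r₂^i)/(r₂ − r₁). Then h₁ + Σ_{i=0}^∞ u_i·(2 + i + c·p) = ( d + (pq + 2)/(pq·(1 + (1−p)(1−q))) )·h₂, where d = c/(q·(1 + (1−p)(1−q))) + (r₂ − 1 + pq)·r₁/((r₂ − r₁)(1 − r₁)²) + (1 − pq − r₁)·r₂/((r₂ − r₁)(1 − r₂)²). -/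
/-- The arithmetic-geometric series `∑ (a + i) r ^ i` for `0 < r < 1`. -/
theorem hasSum_add_coe_mul_geometric {r : ℝ} (h0 : 0 < r) (h1 : r < 1) (a : ℝ) :
    HasSum (fun i : ℕ => (a + (i : ℝ)) * r ^ i) (a * (1 - r)⁻¹ + r / (1 - r) ^ 2) := by
  have hnorm : ‖r‖ < 1 := by rwa [Real.norm_of_nonneg h0.le]
  simpa only [add_mul] using
    ((hasSum_geometric_of_lt_one h0.le h1).mul_left a).add
      (hasSum_coe_mul_geometric_of_norm_lt_one hnorm)

/-- Long-run average cost of the threshold-`2` storage policy: with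
`h₁ = h₂/(1+(1−p)(1−q))` and tail probabilities
`u_i = h₂((r₂−(1−pq))r₁^i + ((1−pq)−r₁)r₂^i)/(r₂−r₁)`,
`h₁ + Σ_{i=0}^∞ u_i(2 + i + cp) = (d + (pq+2)/(pq(1+(1−p)(1−q))))·h₂`, where
`d = c/(q(1+(1−p)(1−q))) + (r₂−1+pq)r₁/((r₂−r₁)(1−r₁)²)
   + (1−pq−r₁)r₂/((r₂−r₁)(1−r₂)²)`. -/
theorem average_cost_threshold_two
    (p q c : ℝ) (hp0 : 0 < p) (hp1 : p < 1) (hq0 : 0 < q) (hq1 : q < 1) (hc : 0 ≤ c)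
    (r₁ r₂ : ℝ) (hr1 : 0 < r₁) (hr12 : r₁ < r₂) (hr2 : r₂ < 1)
    (hsum : r₁ + r₂ = 1 - p * q)
    (hprod : r₁ * r₂ = (1 - p) * p * (1 - q) * q)
    (h₂ : ℝ) (h₁ : ℝ)
    (hh₁ : h₁ = h₂ / (1 + (1 - p) * (1 - q)))
    (u : ℕ → ℝ)
    (hu : ∀ i : ℕ,
      u i = h₂ * ((r₂ - (1 - p * q)) * r₁ ^ i + ((1 - p * q) - r₁) * r₂ ^ i) / (r₂ - r₁))
    (d : ℝ)
    (hd : d = c / (q * (1 + (1 - p) * (1 - q))) +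
      (r₂ - 1 + p * q) * r₁ / ((r₂ - r₁) * (1 - r₁) ^ 2) +
      (1 - p * q - r₁) * r₂ / ((r₂ - r₁) * (1 - r₂) ^ 2)) :
    h₁ + ∑' i : ℕ, u i * (2 + (i : ℝ) + c * p) =
      (d + (p * q + 2) / (p * q * (1 + (1 - p) * (1 - q)))) * h₂ := by
  have hK : 0 < 1 + (1 - p) * (1 - q) := by
    have := mul_pos (sub_pos.2 hp1) (sub_pos.2 hq1)
    linarith
  have hr : r₂ - r₁ ≠ 0 := (sub_pos.2 hr12).ne'
  have hr₁ : 1 - r₁ ≠ 0 := (sub_pos.2 (hr12.trans hr2)).ne'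
  have hr₂ : 1 - r₂ ≠ 0 := (sub_pos.2 hr2).ne'
  have hchar : (1 - r₁) * (1 - r₂) = p * q * (1 + (1 - p) * (1 - q)) := by
    linear_combination hprod - hsum
  have hcost : HasSum (fun i : ℕ => u i * (2 + (i : ℝ) + c * p))
      (h₂ * (r₂ - (1 - p * q)) / (r₂ - r₁) *
          ((2 + c * p) * (1 - r₁)⁻¹ + r₁ / (1 - r₁) ^ 2) +
        h₂ * ((1 - p * q) - r₁) / (r₂ - r₁) *
          ((2 + c * p) * (1 - r₂)⁻¹ + r₂ / (1 - r₂) ^ 2)) := by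
    have hsplit := ((hasSum_add_coe_mul_geometric hr1 (hr12.trans hr2) (2 + c * p)).mul_left
      (h₂ * (r₂ - (1 - p * q)) / (r₂ - r₁))).add
      ((hasSum_add_coe_mul_geometric (hr1.trans hr12) hr2 (2 + c * p)).mul_left
      (h₂ * ((1 - p * q) - r₁) / (r₂ - r₁)))
    refine (congrArg (HasSum · _) (funext fun i => ?_)).mpr hsplit
    rw [hu]
    ring
  have hmass : (r₂ - (1 - p * q)) / (r₂ - r₁) * (1 - r₁)⁻¹ +
      ((1 - p * q) - r₁) / (r₂ - r₁) * (1 - r₂)⁻¹ =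
      1 / (p * q * (1 + (1 - p) * (1 - q))) := by
    rw [← hchar, ← hsum]
    field_simp
    ring
  have hconst : 1 / (1 + (1 - p) * (1 - q)) +
      (2 + c * p) * (1 / (p * q * (1 + (1 - p) * (1 - q)))) =
      c / (q * (1 + (1 - p) * (1 - q))) +
        (p * q + 2) / (p * q * (1 + (1 - p) * (1 - q))) := by
    field_simp
    ring
  rw [hcost.tsum_eq, hh₁, hd]
  simp only [div_eq_mul_inv, mul_inv] at hmass hconst ⊢
  linear_combination h₂ * (2 + c * p) * hmass + h₂ * hconst
end

section
/- Let p, q ∈ (0,1), c ≥ 0, and α ∈ (0,1). Let the state space be 𝒮 = {(v, λ, b) : v an integer with v ≥ 1, λ ∈ {0,1}, b ∈ {0,1}}. Define V₀ : 𝒮 → ℝ by V₀ ≡ 0 and, for n ≥ 0, define V_{n+1} : 𝒮 → ℝ by: V_{n+1}(v,1,b) = min over a ∈ {0,1} of [ a·c + q + (1−q)(v+1) + α·( q·p·V_n(1,1,a) + q(1−p)·V_n(1,0,a) + (1−q)p·V_n(v+1,1,a) + (1−q)(1−p)·V_n(v+1,0,a) ) ]; V_{n+1}(v,0,1) = min over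 a ∈ {0,1} of [ a·c + 2q + (1−q)(v+1) + α·( q·p·V_n(2,1,0) + q(1−p)·V_n(2,0,0) + (1−q)p·V_n(v+1,1,0) + (1−q)(1−p)·V_n(v+1,0,0) ) ]; V_{n+1}(v,0,0) = min over a ∈ {0,1} of [ a·c + (v+1) + α·( p·V_n(v+1,1,0) + (1−p)·V_n(v+1,0,0) ) ]. Then for every n ≥ 0, every λ ∈ {0,1}, every b ∈ {0,1}, and all integers 1 ≤ v₁ ≤ v₂, it holds that V_n(v₁,λ,b) ≤ V_n(v₂,λ,b). -/
/-- Monotonicity in the age of every value-iteration iterate of the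
α-discounted age-plus-storage-cost MDP. The state `(v, λ, b)` is encoded as
`v : ℕ` (with `1 ≤ v`), `lam b : Bool` (`true` ↔ `1`). `V n v lam b` is the
`n`-step value-iteration approximation, `V 0 ≡ 0`, and the recursions below
are the Bellman value-iteration updates, where the minimum ranges over the
store action `a ∈ {0,1}` (first argument: `a = 0`; second: `a = 1`). Then each
`V n` is nondecreasing in the age component `v` on `v ≥ 1`. -/
theorem value_iteration_monotone_in_age
    (p q c α : ℝ) (hp0 : 0 < p) (hp1 : p < 1) (hq0 : 0 < q) (hq1 : q < 1)
    (hc : 0 ≤ c) (hα0 : 0 < α) (hα1 : α < 1)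
    (V : ℕ → ℕ → Bool → Bool → ℝ)
    (hV0 : ∀ (v : ℕ) (lam b : Bool), V 0 v lam b = 0)
    (hVfresh : ∀ (n v : ℕ) (b : Bool), 1 ≤ v →
      V (n + 1) v true b =
        min
          (q + (1 - q) * ((v : ℝ) + 1) +
            α * (q * p * V n 1 true false + q * (1 - p) * V n 1 false false +
              (1 - q) * p * V n (v + 1) true false +
              (1 - q) * (1 - p) * V n (v + 1) false false))
          (c + q + (1 - q) * ((v : ℝ) + 1) +
            α * (q * p * V n 1 true true + q * (1 - p) * V n 1 false true +
              (1 - q) * p * V n (v + 1) true true +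
              (1 - q) * (1 - p) * V n (v + 1) false true)))
    (hVbuffer : ∀ (n v : ℕ), 1 ≤ v →
      V (n + 1) v false true =
        min
          (2 * q + (1 - q) * ((v : ℝ) + 1) +
            α * (q * p * V n 2 true false + q * (1 - p) * V n 2 false false +
              (1 - q) * p * V n (v + 1) true false +
              (1 - q) * (1 - p) * V n (v + 1) false false))
          (c + 2 * q + (1 - q) * ((v : ℝ) + 1) +
            α * (q * p * V n 2 true false + q * (1 - p) * V n 2 false false +
              (1 - q) * p * V n (v + 1) true false +
              (1 - q) * (1 - p) * V n (v + 1) false false)))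
    (hVempty : ∀ (n v : ℕ), 1 ≤ v →
      V (n + 1) v false false =
        min
          (((v : ℝ) + 1) +
            α * (p * V n (v + 1) true false + (1 - p) * V n (v + 1) false false))
          (c + ((v : ℝ) + 1) +
            α * (p * V n (v + 1) true false + (1 - p) * V n (v + 1) false false))) :
    ∀ (n v₁ v₂ : ℕ) (lam b : Bool), 1 ≤ v₁ → v₁ ≤ v₂ →
      V n v₁ lam b ≤ V n v₂ lam b := by
  intro n
  have hp : 0 ≤ 1 - p := by linarith
  have hq : 0 ≤ 1 - q := by linarith
  induction n with
  | zero => intro v₁ v₂ lam b _ _; simp [hV0]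
  | succ n ih =>
    intro v₁ v₂ lam b h₁ h₂
    have hv : (v₁ : ℝ) ≤ v₂ := by exact_mod_cast h₂
    have hnext : ∀ l a, V n (v₁ + 1) l a ≤ V n (v₂ + 1) l a :=
      fun l a => ih _ _ l a (by omega) (by omega)
    cases lam
    · cases b
      · rw [hVempty n v₁ h₁, hVempty n v₂ (h₁.trans h₂)]
        gcongr <;> apply hnext
      · rw [hVbuffer n v₁ h₁, hVbuffer n v₂ (h₁.trans h₂)]
        gcongr <;> apply hnext
    · rw [hVfresh n v₁ b h₁, hVfresh n v₂ b (h₁.trans h₂)]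
      gcongr <;> apply hnext
end

section
/- Let p, q ∈ (0,1) and α ∈ (0,1). Let V : 𝒮 → ℝ be a function on 𝒮 = {(v, λ, b) : v an integer with v ≥ 1, λ ∈ {0,1}, b ∈ {0,1}} satisfying, for every v ≥ 1: V(v,0,1) = 2q + (1−q)(v+1) + α·( q·p·V(2,1,0) + q(1−p)·V(2,0,0) + (1−q)p·V(v+1,1,0) + (1−q)(1−p)·V(v+1,0,0) ) and V(v,0,0) = (v+1) + α·( p·V(v+1,1,0) + (1−p)·V(v+1,0,0) ). Assume moreover that V(v,1,0) ≤ V(v+1,1,0) and V(v,0,0) ≤ V(v+1,0,0) for all v ≥ 1. Then the difference D(v) = V(v,0,1) − V(v,0,0) is nonincreasing in v: D(v+1) ≤ D(v) for every v ≥ 1. -/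
/-- Monotonicity of the buffer-advantage difference. The state `(v, λ, b)` is
encoded as `v : ℕ` (with `1 ≤ v`) and `lam b : Bool` (`true` ↔ `1`). If `V`
satisfies the Bellman equations at the states `(v,0,1)` and `(v,0,0)` and is
nondecreasing in the age at the states `(·,1,0)` and `(·,0,0)`, then the
difference `D(v) = V(v,0,1) − V(v,0,0)` is nonincreasing in `v`. -/
theorem value_difference_nonincreasing
    (p q α : ℝ) (hp0 : 0 < p) (hp1 : p < 1) (hq0 : 0 < q) (hq1 : q < 1)
    (hα0 : 0 < α) (hα1 : α < 1)
    (V : ℕ → Bool → Bool → ℝ)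
    (hbuffer : ∀ v : ℕ, 1 ≤ v →
      V v false true =
        2 * q + (1 - q) * ((v : ℝ) + 1) +
          α * (q * p * V 2 true false + q * (1 - p) * V 2 false false +
            (1 - q) * p * V (v + 1) true false +
            (1 - q) * (1 - p) * V (v + 1) false false))
    (hempty : ∀ v : ℕ, 1 ≤ v →
      V v false false =
        ((v : ℝ) + 1) + α * (p * V (v + 1) true false + (1 - p) * V (v + 1) false false))
    (hmono10 : ∀ v : ℕ, 1 ≤ v → V v true false ≤ V (v + 1) true false)
    (hmono00 : ∀ v : ℕ, 1 ≤ v → V v false false ≤ V (v + 1) false false) :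
    ∀ v : ℕ, 1 ≤ v →
      V (v + 1) false true - V (v + 1) false false ≤
        V v false true - V v false false := by
  have difference_eq : ∀ v : ℕ, 1 ≤ v → V v false true - V v false false =
      2 * q + α * (q * p * V 2 true false + q * (1 - p) * V 2 false false) -
        q * V v false false := fun v hv => by
    linear_combination hbuffer v hv - (1 - q) * hempty v hv
  intro v hv
  rw [difference_eq v hv, difference_eq (v + 1) (by omega)]
  exact sub_le_sub_left (mul_le_mul_of_nonneg_left (hmono00 v hv) hq0.le) _
end

section
/- Let p, q ∈ (0,1), c ≥ 0, and α ∈ (0,1). Let V : 𝒮 → ℝ be a function on 𝒮 = {(v, λ, b) : v an integer with v ≥ 1, λ ∈ {0,1}, b ∈ {0,1}} satisfying, for every v ≥ 1: V(v,0,1) = 2q + (1−q)(v+1) + α·( q·p·V(2,1,0) + q(1−p)·V(2,0,0) + (1−q)p·V(v+1,1,0) + (1−q)(1−p)·V(v+1,0,0) ) and V(v,0,0) = (v+1) + α·( p·V(v+1,1,0) + (1−p)·V(v+1,0,0) ), and assume V(v,1,0) ≤ V(v+1,1,0) and V(v,0,0) ≤ V(v+1,0,0) for all v ≥ 1. If for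 some v ≥ 1 it holds that c + α(1−q)(1−p)·( V(v+1,0,1) − V(v+1,0,0) ) ≤ 0, then for every integer x ≥ 0 it also holds that c + α(1−q)(1−p)·( V(v+1+x,0,1) − V(v+1+x,0,0) ) ≤ 0. -/
/-- Switching (threshold) structure of the storing advantage. The state
`(v, λ, b)` is encoded as `v : ℕ` (with `1 ≤ v`) and `lam b : Bool`
(`true` ↔ `1`). If `V` satisfies the Bellman equations at the states `(v,0,1)`
and `(v,0,0)` and is nondecreasing in the age at the states `(·,1,0)` and
`(·,0,0)`, and if the storing advantage
`c + α(1−q)(1−p)(V(v+1,0,1) − V(v+1,0,0))` is nonpositive at some age `v ≥ 1`,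
then it is nonpositive at every larger age `v + x`. -/
theorem storing_advantage_switching
    (p q c α : ℝ) (hp0 : 0 < p) (hp1 : p < 1) (hq0 : 0 < q) (hq1 : q < 1)
    (hc : 0 ≤ c) (hα0 : 0 < α) (hα1 : α < 1)
    (V : ℕ → Bool → Bool → ℝ)
    (hbuffer : ∀ v : ℕ, 1 ≤ v →
      V v false true =
        2 * q + (1 - q) * ((v : ℝ) + 1) +
          α * (q * p * V 2 true false + q * (1 - p) * V 2 false false +
            (1 - q) * p * V (v + 1) true false +
            (1 - q) * (1 - p) * V (v + 1) false false))
    (hempty : ∀ v : ℕ, 1 ≤ v →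
      V v false false =
        ((v : ℝ) + 1) + α * (p * V (v + 1) true false + (1 - p) * V (v + 1) false false))
    (hmono10 : ∀ v : ℕ, 1 ≤ v → V v true false ≤ V (v + 1) true false)
    (hmono00 : ∀ v : ℕ, 1 ≤ v → V v false false ≤ V (v + 1) false false) :
    ∀ v : ℕ, 1 ≤ v →
      c + α * (1 - q) * (1 - p) * (V (v + 1) false true - V (v + 1) false false) ≤ 0 →
      ∀ x : ℕ,
        c + α * (1 - q) * (1 - p) *
          (V (v + 1 + x) false true - V (v + 1 + x) false false) ≤ 0 := by
  have hstep : ∀ w : ℕ, 1 ≤ w →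
      V (w + 1) false true - V (w + 1) false false ≤ V w false true - V w false false := by
    intro w hw
    -- The Bellman equations make the difference a constant minus `q * V w false false`.
    have hdiff : ∀ u : ℕ, 1 ≤ u → V u false true - V u false false =
        2 * q + α * (q * p * V 2 true false + q * (1 - p) * V 2 false false) -
          q * V u false false := by
      intro u hu
      linear_combination hbuffer u hu - (1 - q) * hempty u hu
    rw [hdiff w hw, hdiff (w + 1) (by omega)]
    have := mul_le_mul_of_nonneg_left (hmono00 w hw) hq0.le
    linarith
  intro v _ h x
  have hcoef : 0 ≤ α * (1 - q) * (1 - p) :=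
    mul_nonneg (mul_nonneg hα0.le (sub_nonneg.2 hq1.le)) (sub_nonneg.2 hp1.le)
  induction x with
  | zero => exact h
  | succ x ih =>
    have := mul_le_mul_of_nonneg_left (hstep (v + 1 + x) (by omega)) hcoef
    rw [← add_assoc (v + 1) x 1]
    linarith
end
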